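/- arXiv:2201.00394 — 7 statements merged into one kernel-verified Lean document; each statement's English description precedes it below -/
import Mathlib

section
/- Let G = (V,E) be a finite undirected graph and let f be a signed total Roman dominating function on G. Define binary vectors x, y : V → {0,1} by x_i = 1 if and only if f(i) ≥ 1, and y_i = 1 if and only if f(i) = 2. Then (x, y) is a feasible solution of the RR^tot formulation, i.e. x_i ≥ y_i, x_i + ∑_{j∈N(i)} y_j ≥ 1, and ∑_{j∈N(i)} (2x_j + y_j − 1) ≥ 1 for all i ∈ V, and its objective value satisfies ∑_{i∈V} (2x_i + y_i − 1) = ∑_{i∈V} f(i). -/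
theorem strdf_gives_rr_tot_feasible
    {V : Type*} [Fintype V] [DecidableEq V] (G : SimpleGraph V) [DecidableRel G.Adj]
    (f : V → ℤ)
    (hf1 : ∀ i, f i = -1 ∨ f i = 1 ∨ f i = 2)
    (hf2 : ∀ i, 1 ≤ ∑ j ∈ G.neighborFinset i, f j)
    (hf3 : ∀ i, f i = -1 → ∃ j ∈ G.neighborFinset i, f j = 2)
    (x y : V → ℤ)
    (hx : ∀ i, x i = if 1 ≤ f i then 1 else 0)
    (hy : ∀ i, y i = if f i = 2 then 1 else 0) :
    (∀ i, y i ≤ x i) ∧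
    (∀ i, 1 ≤ x i + ∑ j ∈ G.neighborFinset i, y j) ∧
    (∀ i, 1 ≤ ∑ j ∈ G.neighborFinset i, (2 * x j + y j - 1)) ∧
    ∑ i, (2 * x i + y i - 1) = ∑ i, f i := by
  have value_eq : ∀ i, 2 * x i + y i - 1 = f i := fun i ↦ by
    rcases hf1 i with h | h | h <;> simp [hx, hy, h]
  have y_nonneg : ∀ i, 0 ≤ y i := fun i ↦ by
    rw [hy]
    split_ifs <;> simp
  refine ⟨fun i ↦ ?_, fun i ↦ ?_, fun i ↦ ?_, ?_⟩
  · rcases hf1 i with h | h | h <;> simp [hx, hy, h]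
  · have sum_nonneg : 0 ≤ ∑ j ∈ G.neighborFinset i, y j :=
      Finset.sum_nonneg fun j _ ↦ y_nonneg j
    by_cases h : 1 ≤ f i
    · rw [hx, if_pos h]
      linarith
    · obtain ⟨j, hj, hfj⟩ := hf3 i (by have := hf1 i; omega)
      have y_le := Finset.single_le_sum (fun k _ ↦ y_nonneg k) hj
      rw [hy j, if_pos hfj] at y_le
      rw [hx, if_neg h]
      linarith
  · simpa only [value_eq] using hf2 i
  · simp only [value_eq]
end

section
/- Let G = (V,E) be a finite undirected graph and let x, y : V → {0,1} be a feasible solution of the BVV^tot formulation, i.e. x_i + y_i ≤ 1, x_i + y_i + ∑_{j∈N(i)} y_j ≥ 1, and ∑_{j∈N(i)} (2x_j + 3y_j − 1) ≥ 1 for all i ∈ V. Then the function f : V → ℤ defined by f(i) = 2x_i + 3y_i − 1 is a signed total Roman dominating function on G, and its weight satisfies ∑_{i∈V} f(i) = ∑_{i∈V} (2x_i + 3y_i − 1). -/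
theorem bvv_tot_feasible_gives_strdf
    {V : Type*} [Fintype V] [DecidableEq V] (G : SimpleGraph V) [DecidableRel G.Adj]
    (x y : V → ℤ)
    (hx : ∀ i, x i = 0 ∨ x i = 1) (hy : ∀ i, y i = 0 ∨ y i = 1)
    (h1 : ∀ i, x i + y i ≤ 1)
    (h2 : ∀ i, 1 ≤ x i + y i + ∑ j ∈ G.neighborFinset i, y j)
    (h3 : ∀ i, 1 ≤ ∑ j ∈ G.neighborFinset i, (2 * x j + 3 * y j - 1))
    (f : V → ℤ) (hf : ∀ i, f i = 2 * x i + 3 * y i - 1) :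
    (∀ i, f i = -1 ∨ f i = 1 ∨ f i = 2) ∧
    (∀ i, 1 ≤ ∑ j ∈ G.neighborFinset i, f j) ∧
    (∀ i, f i = -1 → ∃ j ∈ G.neighborFinset i, f j = 2) ∧
    ∑ i, f i = ∑ i, (2 * x i + 3 * y i - 1) := by
  refine ⟨fun i => ?_, fun i => ?_, fun i hi => ?_, Finset.sum_congr rfl fun i _ => hf i⟩
  · have := hf i
    have := h1 i
    rcases hx i with h | h <;> rcases hy i with h' | h' <;> omega
  · simpa only [hf] using h3 i
  · have hpos : 0 < ∑ j ∈ G.neighborFinset i, y j := by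
      have := hf i
      have := h2 i
      rcases hx i with h | h <;> rcases hy i with h' | h' <;> omega
    obtain ⟨j, hj, hyj⟩ := Finset.exists_lt_of_sum_lt (f := fun _ => (0 : ℤ)) (by simpa using hpos)
    refine ⟨j, hj, ?_⟩
    have := hf j
    have := h1 j
    rcases hx j with h | h <;> rcases hy j with h' | h' <;> omega
end

section
/- Let G = (V,E) be a finite undirected graph and let f be a signed total Roman dominating function on G. Define binary vectors x, y : V → {0,1} by x_i = 1 if and only if f(i) = 1, and y_i = 1 if and only if f(i) = 2. Then (x, y) is a feasible solution of the BVV^tot formulation, i.e. x_i + y_i ≤ 1, x_i + y_i + ∑_{j∈N(i)} y_j ≥ 1, and ∑_{j∈N(i)} (2x_j + 3y_j − 1) ≥ 1 for all i ∈ V, and its objective value satisfies ∑_{i∈V} (2x_i + 3y_i − 1) = ∑_{i∈V} f(i). -/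
theorem strdf_gives_bvv_tot_feasible
    {V : Type*} [Fintype V] [DecidableEq V] (G : SimpleGraph V) [DecidableRel G.Adj]
    (f : V → ℤ)
    (hf1 : ∀ i, f i = -1 ∨ f i = 1 ∨ f i = 2)
    (hf2 : ∀ i, 1 ≤ ∑ j ∈ G.neighborFinset i, f j)
    (hf3 : ∀ i, f i = -1 → ∃ j ∈ G.neighborFinset i, f j = 2)
    (x y : V → ℤ)
    (hx : ∀ i, x i = if f i = 1 then 1 else 0)
    (hy : ∀ i, y i = if f i = 2 then 1 else 0) :
    (∀ i, x i + y i ≤ 1) ∧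
    (∀ i, 1 ≤ x i + y i + ∑ j ∈ G.neighborFinset i, y j) ∧
    (∀ i, 1 ≤ ∑ j ∈ G.neighborFinset i, (2 * x j + 3 * y j - 1)) ∧
    ∑ i, (2 * x i + 3 * y i - 1) = ∑ i, f i := by
  have h : ∀ i, 2 * x i + 3 * y i - 1 = f i := by
    intro i
    rcases hf1 i with hi | hi | hi <;> simp [hx, hy, hi]
  have hy_nonneg : ∀ i, 0 ≤ y i := by
    intro i
    rw [hy]
    split_ifs <;> norm_num
  refine ⟨fun i => ?_, fun i => ?_, fun i => ?_, ?_⟩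
  · rcases hf1 i with hi | hi | hi <;> simp [hx, hy, hi]
  · have hsum : 0 ≤ ∑ j ∈ G.neighborFinset i, y j :=
      Finset.sum_nonneg fun j _ => hy_nonneg j
    rcases hf1 i with hi | hi | hi
    · obtain ⟨j, hj, hfj⟩ := hf3 i hi
      have hle : y j ≤ ∑ k ∈ G.neighborFinset i, y k :=
        Finset.single_le_sum (fun k _ => hy_nonneg k) hj
      have hxi : x i = 0 := by simp [hx, hi]
      have hyj : y j = 1 := by simp [hy, hfj]
      linarith [hy_nonneg i]
    · have hxi : x i = 1 := by simp [hx, hi]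
      linarith [hy_nonneg i]
    · have hxi : x i = 0 := by simp [hx, hi]
      have hyi : y i = 1 := by simp [hy, hi]
      linarith
  · simpa only [h] using hf2 i
  · simp only [h]
end

section
/- Let G = (V,E) be a finite undirected graph and let x, y : V → {0,1} be a feasible solution of the RR formulation, i.e. x_i ≥ y_i, x_i + ∑_{j∈N(i)} y_j ≥ 1, and ∑_{j∈N[i]} (2x_j + y_j − 1) ≥ 1 for all i ∈ V. Then the function f : V → ℤ defined by f(i) = 2x_i + y_i − 1 is a signed Roman dominating function on G, and its weight satisfies ∑_{i∈V} f(i) = ∑_{i∈V} (2x_i + y_i − 1). -/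
theorem rr_feasible_gives_srdf
    {V : Type*} [Fintype V] [DecidableEq V] (G : SimpleGraph V) [DecidableRel G.Adj]
    (x y : V → ℤ)
    (hx : ∀ i, x i = 0 ∨ x i = 1) (hy : ∀ i, y i = 0 ∨ y i = 1)
    (h1 : ∀ i, y i ≤ x i)
    (h2 : ∀ i, 1 ≤ x i + ∑ j ∈ G.neighborFinset i, y j)
    (h3 : ∀ i, 1 ≤ ∑ j ∈ insert i (G.neighborFinset i), (2 * x j + y j - 1))
    (f : V → ℤ) (hf : ∀ i, f i = 2 * x i + y i - 1) :
    (∀ i, f i = -1 ∨ f i = 1 ∨ f i = 2) ∧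
    (∀ i, 1 ≤ ∑ j ∈ insert i (G.neighborFinset i), f j) ∧
    (∀ i, f i = -1 → ∃ j ∈ G.neighborFinset i, f j = 2) ∧
    ∑ i, f i = ∑ i, (2 * x i + y i - 1) := by
  refine ⟨fun i => ?_, fun i => ?_, fun i hi => ?_, Finset.sum_congr rfl fun i _ => hf i⟩
  · have := hf i
    have := h1 i
    rcases hx i with h | h <;> rcases hy i with h' | h' <;> omega
  · simpa only [hf] using h3 i
  · have hxi : x i = 0 := by
      have := hf i
      rcases hx i with h | h <;> rcases hy i with h' | h' <;> omega
    have hsum : 0 < ∑ j ∈ G.neighborFinset i, y j := by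
      have := h2 i
      omega
    obtain ⟨j, hj, hyj⟩ := Finset.exists_lt_of_sum_lt (f := fun _ => (0 : ℤ)) (by simpa using hsum)
    refine ⟨j, hj, ?_⟩
    have := hf j
    have := h1 j
    rcases hx j with h | h <;> rcases hy j with h' | h' <;> omega
end

section
/- Let G = (V,E) be a finite undirected graph and let f be a signed Roman dominating function on G. Define binary vectors x, y : V → {0,1} by x_i = 1 if and only if f(i) ≥ 1, and y_i = 1 if and only if f(i) = 2. Then (x, y) is a feasible solution of the RR formulation, i.e. x_i ≥ y_i, x_i + ∑_{j∈N(i)} y_j ≥ 1, and ∑_{j∈N[i]} (2x_j + y_j − 1) ≥ 1 for all i ∈ V, and its objective value satisfies ∑_{i∈V} (2x_i + y_i − 1) = ∑_{i∈V} f(i). -/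
theorem srdf_gives_rr_feasible
    {V : Type*} [Fintype V] [DecidableEq V] (G : SimpleGraph V) [DecidableRel G.Adj]
    (f : V → ℤ)
    (hf1 : ∀ i, f i = -1 ∨ f i = 1 ∨ f i = 2)
    (hf2 : ∀ i, 1 ≤ ∑ j ∈ insert i (G.neighborFinset i), f j)
    (hf3 : ∀ i, f i = -1 → ∃ j ∈ G.neighborFinset i, f j = 2)
    (x y : V → ℤ)
    (hx : ∀ i, x i = if 1 ≤ f i then 1 else 0)
    (hy : ∀ i, y i = if f i = 2 then 1 else 0) :
    (∀ i, y i ≤ x i) ∧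
    (∀ i, 1 ≤ x i + ∑ j ∈ G.neighborFinset i, y j) ∧
    (∀ i, 1 ≤ ∑ j ∈ insert i (G.neighborFinset i), (2 * x j + y j - 1)) ∧
    ∑ i, (2 * x i + y i - 1) = ∑ i, f i := by
  have weight_eq : ∀ i, 2 * x i + y i - 1 = f i := fun i => by
    rw [hx, hy]
    rcases hf1 i with h | h | h <;> simp [h]
  have y_nonneg : ∀ i, 0 ≤ y i := fun i => by
    rw [hy]
    split_ifs <;> simp
  refine ⟨fun i => ?_, fun i => ?_, fun i => ?_, ?_⟩
  · rw [hx, hy]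
    rcases hf1 i with h | h | h <;> simp [h]
  · have sum_nonneg : 0 ≤ ∑ j ∈ G.neighborFinset i, y j :=
      Finset.sum_nonneg fun j _ => y_nonneg j
    by_cases h : f i = -1
    · obtain ⟨j, hj, hfj⟩ := hf3 i h
      have le_sum : y j ≤ ∑ j ∈ G.neighborFinset i, y j :=
        Finset.single_le_sum (fun j _ => y_nonneg j) hj
      have hyj : y j = 1 := by simp [hy, hfj]
      have hxi : x i = 0 := by simp [hx, h]
      linarith
    · have hxi : x i = 1 := by
        rw [hx, if_pos]
        have := hf1 i
        omega
      linarith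
  · simpa only [weight_eq] using hf2 i
  · simp only [weight_eq]
end

section
/- Let G = (V,E) be a finite undirected graph and let x, y : V → {0,1} be a feasible solution of the BVV formulation, i.e. x_i + y_i ≤ 1, x_i + y_i + ∑_{j∈N(i)} y_j ≥ 1, and ∑_{j∈N[i]} (2x_j + 3y_j − 1) ≥ 1 for all i ∈ V. Then the function f : V → ℤ defined by f(i) = 2x_i + 3y_i − 1 is a signed Roman dominating function on G, and its weight satisfies ∑_{i∈V} f(i) = ∑_{i∈V} (2x_i + 3y_i − 1). -/
theorem bvv_feasible_gives_srdf
    {V : Type*} [Fintype V] [DecidableEq V] (G : SimpleGraph V) [DecidableRel G.Adj]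
    (x y : V → ℤ)
    (hx : ∀ i, x i = 0 ∨ x i = 1) (hy : ∀ i, y i = 0 ∨ y i = 1)
    (h1 : ∀ i, x i + y i ≤ 1)
    (h2 : ∀ i, 1 ≤ x i + y i + ∑ j ∈ G.neighborFinset i, y j)
    (h3 : ∀ i, 1 ≤ ∑ j ∈ insert i (G.neighborFinset i), (2 * x j + 3 * y j - 1))
    (f : V → ℤ) (hf : ∀ i, f i = 2 * x i + 3 * y i - 1) :
    (∀ i, f i = -1 ∨ f i = 1 ∨ f i = 2) ∧
    (∀ i, 1 ≤ ∑ j ∈ insert i (G.neighborFinset i), f j) ∧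
    (∀ i, f i = -1 → ∃ j ∈ G.neighborFinset i, f j = 2) ∧
    ∑ i, f i = ∑ i, (2 * x i + 3 * y i - 1) := by
  obtain rfl : f = fun i => 2 * x i + 3 * y i - 1 := funext hf
  refine ⟨fun i => ?_, h3, fun i hi => ?_, rfl⟩
  · grind
  · have hxy : x i + y i = 0 := by grind
    have hpos : 0 < ∑ j ∈ G.neighborFinset i, y j := by linarith [h2 i]
    obtain ⟨j, hj, hyj⟩ := Finset.exists_lt_of_sum_lt
      (f := fun _ => (0 : ℤ)) (by simpa only [Finset.sum_const_zero] using hpos)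
    exact ⟨j, hj, by grind⟩
end

section
/- Let G = (V,E) be a finite undirected graph and let f be a signed Roman dominating function on G. Define binary vectors x, y : V → {0,1} by x_i = 1 if and only if f(i) = 1, and y_i = 1 if and only if f(i) = 2. Then (x, y) is a feasible solution of the BVV formulation, i.e. x_i + y_i ≤ 1, x_i + y_i + ∑_{j∈N(i)} y_j ≥ 1, and ∑_{j∈N[i]} (2x_j + 3y_j − 1) ≥ 1 for all i ∈ V, and its objective value satisfies ∑_{i∈V} (2x_i + 3y_i − 1) = ∑_{i∈V} f(i). -/
theorem srdf_gives_bvv_feasible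
    {V : Type*} [Fintype V] [DecidableEq V] (G : SimpleGraph V) [DecidableRel G.Adj]
    (f : V → ℤ)
    (hf1 : ∀ i, f i = -1 ∨ f i = 1 ∨ f i = 2)
    (hf2 : ∀ i, 1 ≤ ∑ j ∈ insert i (G.neighborFinset i), f j)
    (hf3 : ∀ i, f i = -1 → ∃ j ∈ G.neighborFinset i, f j = 2)
    (x y : V → ℤ)
    (hx : ∀ i, x i = if f i = 1 then 1 else 0)
    (hy : ∀ i, y i = if f i = 2 then 1 else 0) :
    (∀ i, x i + y i ≤ 1) ∧
    (∀ i, 1 ≤ x i + y i + ∑ j ∈ G.neighborFinset i, y j) ∧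
    (∀ i, 1 ≤ ∑ j ∈ insert i (G.neighborFinset i), (2 * x j + 3 * y j - 1)) ∧
    ∑ i, (2 * x i + 3 * y i - 1) = ∑ i, f i := by
  have weight_eq (i : V) : 2 * x i + 3 * y i - 1 = f i := by
    rcases hf1 i with h | h | h <;> simp [hx, hy, h]
  have y_nonneg (i : V) : 0 ≤ y i := by
    rw [hy]; split_ifs <;> norm_num
  refine ⟨fun i => ?_, fun i => ?_, fun i => ?_, ?_⟩
  · rcases hf1 i with h | h | h <;> simp [hx, hy, h]
  · have sum_nonneg : 0 ≤ ∑ j ∈ G.neighborFinset i, y j :=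
      Finset.sum_nonneg fun j _ => y_nonneg j
    rcases hf1 i with h | h | h
    · obtain ⟨j, hj, hfj⟩ := hf3 i h
      have hle := Finset.single_le_sum (fun k _ => y_nonneg k) hj
      have hyj : y j = 1 := by simp [hy, hfj]
      have hxi : x i = 0 := by simp [hx, h]
      linarith [y_nonneg i]
    · have hxi : x i = 1 := by simp [hx, h]
      linarith [y_nonneg i]
    · have hxi : x i = 0 := by simp [hx, h]
      have hyi : y i = 1 := by simp [hy, h]
      linarith
  · simpa only [weight_eq] using hf2 i
  · simp only [weight_eq]
end
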